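/- arXiv:1603.00311 — 4 statements merged into one kernel-verified Lean document; each statement's English description precedes it below -/
import Mathlib

section
/- Let n ≥ m ≥ 1 and let A be a real m×n matrix of rank m. If ξ is a random vector uniformly distributed on the closed unit Euclidean ball B^n ⊂ ℝ^n, then the random variable ρ = ⟨(A Aᵀ)⁻¹ A ξ, A ξ⟩ has the beta distribution with parameters (m/2, (n−m)/2 + 1); that is, for every x ∈ [0,1], P{ρ ≤ x} = (Γ(n/2+1)/(Γ(m/2) Γ((n−m)/2+1))) · ∫₀ˣ t^{m/2−1} (1−t)^{(n−m)/2} dt. -/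
open MeasureTheory Matrix

/-- The uniform probability measure on the closed unit Euclidean ball in `ℝⁿ`
(Lebesgue measure restricted to the ball, normalized by its volume). -/
noncomputable def unifBall (n : ℕ) : Measure (Fin n → ℝ) :=
  (volume {x : Fin n → ℝ | ∑ i, (x i) ^ 2 ≤ 1})⁻¹ •
    volume.restrict {x : Fin n → ℝ | ∑ i, (x i) ^ 2 ≤ 1}

section

open Module Metric Set

/-- Substituting `t = y ^ 2` turns the radial integral of a ball section into an incomplete beta
integral. -/
theorem integral_Ioi_norm_profile (d e : ℕ) (hd : 1 ≤ d) {x : ℝ} (hx : x ∈ Icc (0 : ℝ) 1) :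
    ∫ y in Ioi (0 : ℝ), y ^ (d - 1) * (if y ^ 2 ≤ x then √(1 - y ^ 2) ^ e else 0) =
      2⁻¹ * ∫ t in (0 : ℝ)..x, t ^ ((d : ℝ) / 2 - 1) * (1 - t) ^ ((e : ℝ) / 2) := by
  have h := integral_comp_rpow_Ioi_of_pos (p := 2) (by norm_num)
    (g := (Iic x).indicator fun t : ℝ => t ^ ((d : ℝ) / 2 - 1) * (1 - t) ^ ((e : ℝ) / 2))
  rw [setIntegral_indicator measurableSet_Iic, Ioi_inter_Iic] at h
  rw [intervalIntegral.integral_of_le hx.1, ← h, ← integral_const_mul]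
  refine setIntegral_congr_fun measurableSet_Ioi fun y (hy : 0 < y) => ?_
  simp only [Real.rpow_two, indicator_apply, mem_Iic, smul_eq_mul]
  split_ifs with hyx
  · have h1 : (y ^ 2) ^ ((d : ℝ) / 2 - 1) * y = y ^ (d - 1) := by
      rw [← Real.rpow_two, ← Real.rpow_mul hy.le, ← Real.rpow_add_one hy.ne', ← Real.rpow_natCast,
        Nat.cast_sub hd]
      congr 1
      push_cast
      ring
    have h2 : √(1 - y ^ 2) ^ e = (1 - y ^ 2) ^ ((e : ℝ) / 2) := by
      rw [Real.sqrt_eq_rpow, ← Real.rpow_natCast, ← Real.rpow_mul (by linarith [hx.2])]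
      congr 1
      ring
    rw [← h1, h2]
    norm_num
    ring
  · simp

theorem integral_rpow_mul_one_sub_rpow {a b : ℝ} (ha : 0 < a) (hb : 0 < b) :
    ∫ t in (0 : ℝ)..1, t ^ (a - 1) * (1 - t) ^ (b - 1) =
      Real.Gamma a * Real.Gamma b / Real.Gamma (a + b) := by
  have h := ProbabilityTheory.beta_eq_betaIntegralReal a b ha hb
  rw [ProbabilityTheory.beta] at h
  rw [h, Complex.betaIntegral, ← Complex.ofReal_re (∫ t in (0 : ℝ)..1, _),
    ← intervalIntegral.integral_ofReal]
  congr 1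
  refine intervalIntegral.integral_congr fun t ht => ?_
  rw [uIcc_of_le zero_le_one] at ht
  push_cast [Complex.ofReal_cpow ht.1, Complex.ofReal_cpow (sub_nonneg.2 ht.2)]
  rfl

theorem measurableSet_prod_sq_norm_le {U V : Type*} [NormedAddCommGroup U] [MeasurableSpace U]
    [BorelSpace U] [NormedAddCommGroup V] [MeasurableSpace V] [BorelSpace V]
    [SecondCountableTopology V] (x : ℝ) :
    MeasurableSet {p : U × V | ‖p.1‖ ^ 2 + ‖p.2‖ ^ 2 ≤ 1 ∧ ‖p.1‖ ^ 2 ≤ x} := by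
  have h1 : IsClosed {p : U × V | ‖p.1‖ ^ 2 + ‖p.2‖ ^ 2 ≤ 1} :=
    isClosed_le (by fun_prop) (by fun_prop)
  have h2 : IsClosed {p : U × V | ‖p.1‖ ^ 2 ≤ x} := isClosed_le (by fun_prop) (by fun_prop)
  exact (h1.inter h2).measurableSet

variable {E U V : Type*}
  [NormedAddCommGroup E] [InnerProductSpace ℝ E] [FiniteDimensional ℝ E] [MeasurableSpace E]
  [BorelSpace E]
  [NormedAddCommGroup U] [InnerProductSpace ℝ U] [FiniteDimensional ℝ U] [MeasurableSpace U]
  [BorelSpace U]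
  [NormedAddCommGroup V] [InnerProductSpace ℝ V] [FiniteDimensional ℝ V] [MeasurableSpace V]
  [BorelSpace V]

theorem measureReal_prod_sq_norm_le [Nontrivial U] {x : ℝ} (hx : x ∈ Icc (0 : ℝ) 1) :
    (volume : Measure (U × V)).real {p | ‖p.1‖ ^ 2 + ‖p.2‖ ^ 2 ≤ 1 ∧ ‖p.1‖ ^ 2 ≤ x} =
      finrank ℝ U * volume.real (ball (0 : U) 1) * volume.real (ball (0 : V) 1) * 2⁻¹ *
        ∫ t in (0 : ℝ)..x, t ^ ((finrank ℝ U : ℝ) / 2 - 1) * (1 - t) ^ ((finrank ℝ V : ℝ) / 2) := by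
  set S : Set (U × V) := {p | ‖p.1‖ ^ 2 + ‖p.2‖ ^ 2 ≤ 1 ∧ ‖p.1‖ ^ 2 ≤ x}
  have hS : MeasurableSet S := measurableSet_prod_sq_norm_le x
  have hslice (u : U) : (Prod.mk u ⁻¹' S) =
      if ‖u‖ ^ 2 ≤ x then closedBall (0 : V) (√(1 - ‖u‖ ^ 2)) else ∅ := by
    split_ifs with hu
    · ext v
      simp only [S, mem_preimage, mem_ofPred_eq, hu, and_true, mem_closedBall_zero_iff]
      rw [Real.le_sqrt (norm_nonneg v), le_sub_iff_add_le']
      exact sub_nonneg.2 (hu.trans hx.2)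
    · ext v
      simp [S, hu]
  have hvol (u : U) : (volume (Prod.mk u ⁻¹' S)).toReal =
      (if ‖u‖ ^ 2 ≤ x then √(1 - ‖u‖ ^ 2) ^ finrank ℝ V else 0) * volume.real (ball (0 : V) 1) := by
    rw [hslice]
    split_ifs with hu
    · exact Measure.addHaar_real_closedBall _ _ (Real.sqrt_nonneg _)
    · simp
  have hfin (u : U) : volume (Prod.mk u ⁻¹' S) < ⊤ := by
    rw [hslice]
    split_ifs with hu
    · exact measure_closedBall_lt_top
    · simp
  rw [Measure.real, Measure.volume_eq_prod, Measure.prod_apply hS,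
    ← integral_toReal (measurable_measure_prodMk_left hS).aemeasurable (.of_forall hfin)]
  simp_rw [hvol]
  rw [integral_mul_const, integral_fun_norm_addHaar volume
    (fun y => if y ^ 2 ≤ x then √(1 - y ^ 2) ^ finrank ℝ V else 0)]
  simp only [smul_eq_mul, nsmul_eq_mul]
  rw [integral_Ioi_norm_profile _ _ finrank_pos hx]
  ring

theorem measureReal_norm_le_one_sq_norm_projection_le (K : Submodule ℝ E) [Nontrivial K] {x : ℝ}
    (hx : x ∈ Icc (0 : ℝ) 1) :
    volume.real {ξ : E | ‖ξ‖ ≤ 1 ∧ ‖K.starProjection ξ‖ ^ 2 ≤ x} =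
      finrank ℝ K * volume.real (ball (0 : K) 1) * volume.real (ball (0 : Kᗮ) 1) * 2⁻¹ *
        ∫ t in (0 : ℝ)..x, t ^ ((finrank ℝ K : ℝ) / 2 - 1) * (1 - t) ^ ((finrank ℝ Kᗮ : ℝ) / 2) := by
  have hmp : MeasurePreserving (fun ξ : E => WithLp.ofLp (K.orthogonalDecomposition ξ)) :=
    (WithLp.volume_preserving_ofLp K Kᗮ).comp K.orthogonalDecomposition.measurePreserving
  rw [← measureReal_prod_sq_norm_le hx,
    ← hmp.measureReal_preimage (measurableSet_prod_sq_norm_le x).nullMeasurableSet]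
  congr 1
  ext ξ
  have h := K.norm_sq_eq_add_norm_sq_projection ξ
  simp only [mem_ofPred_eq, mem_preimage, Submodule.orthogonalDecomposition_apply]
  rw [← sq_le_one_iff₀ (norm_nonneg ξ), h]
  rfl

/-- The squared norm of the orthogonal projection onto a nontrivial subspace of a uniform random
point of the closed unit ball is beta distributed. -/
theorem volume_sq_norm_projection_le_div (K : Submodule ℝ E) [Nontrivial K] {x : ℝ}
    (hx : x ∈ Icc (0 : ℝ) 1) :
    (volume {ξ : E | ‖ξ‖ ≤ 1})⁻¹ * volume {ξ : E | ‖ξ‖ ≤ 1 ∧ ‖K.starProjection ξ‖ ^ 2 ≤ x} =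
      ENNReal.ofReal
        (Real.Gamma ((finrank ℝ E : ℝ) / 2 + 1) /
            (Real.Gamma ((finrank ℝ K : ℝ) / 2) * Real.Gamma ((finrank ℝ Kᗮ : ℝ) / 2 + 1)) *
          ∫ t in (0 : ℝ)..x,
            t ^ ((finrank ℝ K : ℝ) / 2 - 1) * (1 - t) ^ ((finrank ℝ Kᗮ : ℝ) / 2)) := by
  have hball : {ξ : E | ‖ξ‖ ≤ 1} = closedBall 0 1 := by ext; simp
  have hone : {ξ : E | ‖ξ‖ ≤ 1} = {ξ : E | ‖ξ‖ ≤ 1 ∧ ‖K.starProjection ξ‖ ^ 2 ≤ 1} := by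
    ext ξ
    refine ⟨fun h => ⟨h, ?_⟩, And.left⟩
    exact (sq_le_one_iff₀ (norm_nonneg _)).2 ((K.norm_starProjection_apply_le ξ).trans h)
  have hfin : volume {ξ : E | ‖ξ‖ ≤ 1} ≠ ⊤ := hball ▸ measure_closedBall_lt_top.ne
  have hpos : 0 < volume.real {ξ : E | ‖ξ‖ ≤ 1} := by
    rw [hball]
    exact ENNReal.toReal_pos (measure_closedBall_pos _ _ one_pos).ne' measure_closedBall_lt_top.ne
  have hfin' : volume {ξ : E | ‖ξ‖ ≤ 1 ∧ ‖K.starProjection ξ‖ ^ 2 ≤ x} ≠ ⊤ :=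
    measure_ne_top_of_subset (fun _ h => h.1) hfin
  have hK : (0 : ℝ) < finrank ℝ K := by exact_mod_cast finrank_pos
  have hbeta := integral_rpow_mul_one_sub_rpow (a := (finrank ℝ K : ℝ) / 2)
    (b := (finrank ℝ Kᗮ : ℝ) / 2 + 1) (by positivity) (by positivity)
  rw [add_sub_cancel_right] at hbeta
  have hdim : (finrank ℝ K : ℝ) / 2 + ((finrank ℝ Kᗮ : ℝ) / 2 + 1) = (finrank ℝ E : ℝ) / 2 + 1 := by
    rw [← K.finrank_add_finrank_orthogonal]
    push_cast
    ring
  have htotal := measureReal_norm_le_one_sq_norm_projection_le K (right_mem_Icc.2 zero_le_one)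
  rw [← hone, hbeta, hdim] at htotal
  rw [← ofReal_measureReal hfin, ← ofReal_measureReal hfin', ← ENNReal.ofReal_inv_of_pos hpos,
    ← ENNReal.ofReal_mul (inv_nonneg.2 hpos.le),
    measureReal_norm_le_one_sq_norm_projection_le K hx]
  congr 1
  rw [htotal] at hpos ⊢
  have hc := left_ne_zero_of_mul hpos.ne'
  rw [mul_inv, inv_div, mul_mul_mul_comm, inv_mul_cancel₀ hc, one_mul]

/-- The quadratic form `⟨(A Aᵀ)⁻¹ A ξ, A ξ⟩` is the squared norm of the orthogonal projection of `ξ`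
onto the row space of `A`. -/
theorem inv_mul_transpose_mulVec_dotProduct {ι κ : Type*} [Fintype ι] [Fintype κ] [DecidableEq ι]
    [DecidableEq κ] (A : Matrix ι κ ℝ) (hA : IsUnit (A * Aᵀ).det) (ξ : EuclideanSpace ℝ κ) :
    ((A * Aᵀ)⁻¹ *ᵥ (A *ᵥ ξ.ofLp)) ⬝ᵥ (A *ᵥ ξ.ofLp) =
      ‖(LinearMap.range (toEuclideanLin Aᵀ)).starProjection ξ‖ ^ 2 := by
  have hcancel : A *ᵥ (Aᵀ *ᵥ ((A * Aᵀ)⁻¹ *ᵥ (A *ᵥ ξ.ofLp))) = A *ᵥ ξ.ofLp := by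
    rw [mulVec_mulVec, mulVec_mulVec, mul_nonsing_inv _ hA, one_mulVec]
  have hproj : (LinearMap.range (toEuclideanLin Aᵀ)).starProjection ξ =
      toEuclideanLin Aᵀ (WithLp.toLp 2 ((A * Aᵀ)⁻¹ *ᵥ (A *ᵥ ξ.ofLp))) := by
    refine Submodule.eq_starProjection_of_mem_of_inner_eq_zero ⟨_, rfl⟩ ?_
    rintro _ ⟨w, rfl⟩
    rw [EuclideanSpace.inner_eq_star_dotProduct]
    simp only [star_trivial, WithLp.ofLp_sub, ofLp_toLpLin, toLin'_apply]
    rw [mulVec_transpose A w.ofLp, ← dotProduct_mulVec, mulVec_sub, hcancel, sub_self,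
      dotProduct_zero]
  rw [hproj, ← real_inner_self_eq_norm_sq, EuclideanSpace.inner_eq_star_dotProduct]
  simp only [star_trivial, ofLp_toLpLin, toLin'_apply]
  nth_rw 1 [mulVec_transpose]
  rw [← dotProduct_mulVec, hcancel]

theorem isUnit_det_mul_transpose_of_rank_eq_card {ι κ : Type*} [Fintype ι] [Fintype κ]
    [DecidableEq ι] (A : Matrix ι κ ℝ) (hA : A.rank = Fintype.card ι) : IsUnit (A * Aᵀ).det := by
  rw [← isUnit_iff_isUnit_det, ← mulVec_surjective_iff_isUnit]
  refine LinearMap.range_eq_top (f := (A * Aᵀ).mulVecLin).1 (Submodule.eq_top_of_finrank_eq ?_)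
  rw [← Matrix.rank, rank_self_mul_transpose, hA, finrank_fintype_fun_eq_card]

theorem finrank_range_toEuclideanLin {ι κ : Type*} [Fintype ι] [Fintype κ] [DecidableEq κ]
    (A : Matrix ι κ ℝ) : finrank ℝ (LinearMap.range (toEuclideanLin A)) = A.rank := by
  classical
  rw [toEuclideanLin_eq_toLin_orthonormal, ← rank_eq_finrank_range_toLin]

end

/-- Fact 1: if `ξ` is uniform on the unit ball in `ℝⁿ` and `A` is an `m × n` matrix of
rank `m`, then `ρ = ⟨(A Aᵀ)⁻¹ A ξ, A ξ⟩` has the beta distribution `B(m/2, (n-m)/2 + 1)`: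
its cdf on `[0,1]` is the corresponding incomplete beta integral. -/
theorem stmt_0 (m n : ℕ) (hm : 1 ≤ m) (hmn : m ≤ n)
    (A : Matrix (Fin m) (Fin n) ℝ) (hA : A.rank = m)
    (x : ℝ) (hx : x ∈ Set.Icc (0 : ℝ) 1) :
    unifBall n {ξ : Fin n → ℝ | ((A * Aᵀ)⁻¹ *ᵥ (A *ᵥ ξ)) ⬝ᵥ (A *ᵥ ξ) ≤ x} =
      ENNReal.ofReal
        ((Real.Gamma ((n : ℝ) / 2 + 1) /
            (Real.Gamma ((m : ℝ) / 2) * Real.Gamma (((n : ℝ) - m) / 2 + 1))) *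
          ∫ t in (0 : ℝ)..x, t ^ ((m : ℝ) / 2 - 1) * (1 - t) ^ (((n : ℝ) - m) / 2)) := by
  set K := LinearMap.range (toEuclideanLin Aᵀ)
  have hKm : Module.finrank ℝ K = m := by rw [finrank_range_toEuclideanLin, rank_transpose, hA]
  have hKn : (Module.finrank ℝ Kᗮ : ℝ) = n - m := by
    have h := K.finrank_add_finrank_orthogonal
    rw [hKm, finrank_euclideanSpace_fin] at h
    rw [eq_sub_iff_add_eq', ← Nat.cast_add, h]
  have : Nontrivial K := Module.nontrivial_of_finrank_pos (R := ℝ) (hKm ▸ hm)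
  have hunit := isUnit_det_mul_transpose_of_rank_eq_card A (by simpa using hA)
  have hB : MeasurableSet {ξ : Fin n → ℝ | ∑ i, (ξ i) ^ 2 ≤ 1} :=
    (isClosed_le (by fun_prop) (by fun_prop)).measurableSet
  have hS : MeasurableSet {ξ : Fin n → ℝ | ((A * Aᵀ)⁻¹ *ᵥ (A *ᵥ ξ)) ⬝ᵥ (A *ᵥ ξ) ≤ x} :=
    (isClosed_le (by fun_prop) (by fun_prop)).measurableSet
  have hmp := PiLp.volume_preserving_ofLp (Fin n)
  have hnorm (ξ : EuclideanSpace ℝ (Fin n)) : ∑ i, (ξ.ofLp i) ^ 2 ≤ 1 ↔ ‖ξ‖ ≤ 1 := by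
    rw [← sq_le_one_iff₀ (norm_nonneg ξ), EuclideanSpace.real_norm_sq_eq]
  have hmain := volume_sq_norm_projection_le_div K hx
  rw [hKm, hKn, finrank_euclideanSpace_fin] at hmain
  rw [unifBall, Measure.smul_apply, smul_eq_mul, Measure.restrict_apply hS,
    ← hmp.measure_preimage hB.nullMeasurableSet,
    ← hmp.measure_preimage (hS.inter hB).nullMeasurableSet, ← hmain]
  congr 3
  · ext ξ
    exact hnorm ξ
  · ext ξ
    change _ ≤ x ∧ _ ≤ (1 : ℝ) ↔ _
    rw [hnorm, inv_mul_transpose_mulVec_dotProduct A hunit, and_comm]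
    rfl
end

section
/- Let n ≥ 2, N ≥ 1, let c₁, c₂ ∈ ℝ^n be orthonormal vectors, and let ξ^{(1)},…,ξ^{(N)} be i.i.d. random vectors, each uniformly distributed on the closed unit Euclidean ball B^n ⊂ ℝ^n. Define κ = max_{1≤i≤N} ‖g(ξ^{(i)})‖₂, where g(x) = (c₁ᵀx, c₂ᵀx) ∈ ℝ². Then for every δ ∈ (0,1), P{κ > 1−δ} = 1 − (1 − (2δ − δ²)^{n/2})^N. -/
open MeasureTheory Matrix

/-- Volumes of Euclidean balls in `Fin n → ℝ` scale like the `n`-th power of the radius. -/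
theorem volume_sum_sq_le (n : ℕ) {a : ℝ} (ha : 0 ≤ a) :
    volume {x : Fin n → ℝ | ∑ i, (x i) ^ 2 ≤ a} =
      ENNReal.ofReal (a ^ ((n : ℝ) / 2)) * volume {x : Fin n → ℝ | ∑ i, (x i) ^ 2 ≤ 1} := by
  have key : ∀ b : ℝ, 0 ≤ b → volume {x : Fin n → ℝ | ∑ i, (x i) ^ 2 ≤ b} =
      volume (Metric.closedBall (0 : EuclideanSpace ℝ (Fin n)) (√b)) := by
    intro b hb
    rw [← (EuclideanSpace.volume_preserving_symm_measurableEquiv_toLp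
      (Fin n)).symm.measure_preimage_equiv]
    congr 1
    ext x
    simp [EuclideanSpace.norm_eq, Real.sqrt_le_sqrt_iff hb]
  rw [key a ha, key 1 zero_le_one, Measure.addHaar_closedBall' _ _ (Real.sqrt_nonneg a),
    Real.sqrt_one, finrank_euclideanSpace, Fintype.card_fin, Real.sqrt_eq_rpow,
    ← Real.rpow_mul_natCast ha]
  congr 3
  ring

theorem measurableSet_sum_sq_le (n : ℕ) (a : ℝ) :
    MeasurableSet {x : Fin n → ℝ | ∑ i, (x i) ^ 2 ≤ a} :=
  measurableSet_le (by fun_prop) measurable_const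

theorem volume_sum_sq_le_ne_top (n : ℕ) (a : ℝ) :
    volume {x : Fin n → ℝ | ∑ i, (x i) ^ 2 ≤ a} ≠ ⊤ := by
  refine ne_top_of_le_ne_top (measure_closedBall_lt_top (x := (0 : Fin n → ℝ)) (r := √a)).ne
    (measure_mono fun x hx ↦ ?_)
  rw [mem_closedBall_zero_iff, pi_norm_le_iff_of_nonneg (Real.sqrt_nonneg a)]
  intro i
  refine Real.le_sqrt_of_sq_le ?_
  rw [Real.norm_eq_abs, sq_abs]
  exact (Finset.single_le_sum (fun j _ ↦ sq_nonneg (x j)) (Finset.mem_univ i)).trans hx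

theorem volume_sum_sq_le_one_ne_zero (n : ℕ) :
    volume {x : Fin n → ℝ | ∑ i, (x i) ^ 2 ≤ 1} ≠ 0 := by
  have hopen : IsOpen {x : Fin n → ℝ | ∑ i, (x i) ^ 2 < 1} :=
    isOpen_lt (by fun_prop) continuous_const
  refine ne_of_gt ((hopen.measure_pos volume ⟨0, by simp⟩).trans_le (measure_mono fun x hx ↦ ?_))
  simp only [Set.mem_ofPred_eq] at hx ⊢
  exact hx.le

instance isProbabilityMeasure_unifBall (n : ℕ) : IsProbabilityMeasure (unifBall n) where
  measure_univ := by
    simp only [unifBall, Measure.smul_apply, Measure.restrict_apply_univ, smul_eq_mul]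
    exact ENNReal.inv_mul_cancel (volume_sum_sq_le_one_ne_zero n) (volume_sum_sq_le_ne_top n 1)

/-- A planar annulus has the area of a disc with the same difference of squared radii. -/
theorem volume_annulus {s t : ℝ} (hs : 0 ≤ s) :
    volume {y : Fin 2 → ℝ | ∑ i, (y i) ^ 2 ≤ t ∧ s < ∑ i, (y i) ^ 2} =
      volume {y : Fin 2 → ℝ | ∑ i, (y i) ^ 2 ≤ t - s} := by
  rcases lt_or_ge t s with h | h
  · have h₁ : {y : Fin 2 → ℝ | ∑ i, (y i) ^ 2 ≤ t ∧ s < ∑ i, (y i) ^ 2} = ∅ := by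
      ext y
      simp only [Set.mem_ofPred_eq, Set.mem_empty_iff_false, iff_false]
      rintro ⟨h1, h2⟩
      linarith
    have h₂ : {y : Fin 2 → ℝ | ∑ i, (y i) ^ 2 ≤ t - s} = ∅ := by
      ext y
      have : 0 ≤ ∑ i, (y i) ^ 2 := Finset.sum_nonneg fun i _ ↦ sq_nonneg _
      simp only [Set.mem_ofPred_eq, Set.mem_empty_iff_false, iff_false]
      intro h1
      linarith
    rw [h₁, h₂]
  · have hdiff : {y : Fin 2 → ℝ | ∑ i, (y i) ^ 2 ≤ t ∧ s < ∑ i, (y i) ^ 2} =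
        {y | ∑ i, (y i) ^ 2 ≤ t} \ {y | ∑ i, (y i) ^ 2 ≤ s} := by
      ext y
      simp
    have hsub : {y : Fin 2 → ℝ | ∑ i, (y i) ^ 2 ≤ s} ⊆ {y | ∑ i, (y i) ^ 2 ≤ t} := by
      intro y hy
      simp only [Set.mem_ofPred_eq] at hy ⊢
      exact hy.trans h
    rw [hdiff, measure_sdiff hsub
      (measurableSet_sum_sq_le 2 s).nullMeasurableSet (volume_sum_sq_le_ne_top 2 s),
      volume_sum_sq_le 2 hs, volume_sum_sq_le 2 (hs.trans h), volume_sum_sq_le 2 (sub_nonneg.2 h),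
      ← ENNReal.sub_mul fun _ _ ↦ volume_sum_sq_le_ne_top 2 1]
    simp [ENNReal.ofReal_sub _ hs]

/-- Orthonormal coordinates adapted to `c₁, c₂`. -/
theorem exists_measurePreserving_coordinates (m : ℕ) (c₁ c₂ : Fin (2 + m) → ℝ)
    (hc₁ : ∑ i, (c₁ i) ^ 2 = 1) (hc₂ : ∑ i, (c₂ i) ^ 2 = 1) (hortho : c₁ ⬝ᵥ c₂ = 0) :
    ∃ T : (Fin (2 + m) → ℝ) → (Fin 2 → ℝ) × (Fin m → ℝ),
      MeasurePreserving T volume volume ∧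
      (∀ x, ∑ i, (x i) ^ 2 = ∑ i, ((T x).1 i) ^ 2 + ∑ i, ((T x).2 i) ^ 2) ∧
      ∀ x, (c₁ ⬝ᵥ x) ^ 2 + (c₂ ⬝ᵥ x) ^ 2 = ∑ i, ((T x).1 i) ^ 2 := by
  let v : Fin 2 ⊕ Fin m → EuclideanSpace ℝ (Fin (2 + m)) :=
    Sum.elim ![WithLp.toLp 2 c₁, WithLp.toLp 2 c₂] 0
  have hv : Orthonormal ℝ ((Set.range Sum.inl).domRestrict v) := by
    have hortho' : c₂ ⬝ᵥ c₁ = 0 := by rw [dotProduct_comm, hortho]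
    have h₁ : c₁ ⬝ᵥ c₁ = 1 := by simpa [dotProduct, sq] using hc₁
    have h₂ : c₂ ⬝ᵥ c₂ = 1 := by simpa [dotProduct, sq] using hc₂
    rw [orthonormal_iff_ite]
    rintro ⟨_, i, rfl⟩ ⟨_, j, rfl⟩
    fin_cases i <;> fin_cases j <;>
      simp [-inner_self_eq_norm_sq_to_K, Set.domRestrict_apply, v,
        EuclideanSpace.inner_toLp_toLp, hortho, hortho', h₁, h₂]
  obtain ⟨b, hb⟩ := hv.exists_orthonormalBasis_extension_of_card_eq (by simp)
  refine ⟨fun x ↦ MeasurableEquiv.sumPiEquivProdPi (fun _ : Fin 2 ⊕ Fin m ↦ ℝ)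
    (WithLp.ofLp (b.repr (WithLp.toLp 2 x))), ?_, ?_, ?_⟩
  · exact (volume_measurePreserving_sumPiEquivProdPi _).comp
      ((PiLp.volume_preserving_ofLp _).comp
        (b.repr.measurePreserving.comp (PiLp.volume_preserving_toLp _)))
  · intro x
    have h := b.repr.norm_map (WithLp.toLp 2 x)
    have h' := congrArg (· ^ 2) h
    simp only [EuclideanSpace.norm_sq_eq, Real.norm_eq_abs, sq_abs, Fintype.sum_sum_type] at h'
    exact h'.symm
  · intro x
    have h₁ : b.repr (WithLp.toLp 2 x) (Sum.inl 0) = c₁ ⬝ᵥ x := by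
      rw [b.repr_apply_apply, hb _ ⟨0, rfl⟩]
      simp [v, EuclideanSpace.inner_toLp_toLp, dotProduct_comm]
    have h₂ : b.repr (WithLp.toLp 2 x) (Sum.inl 1) = c₂ ⬝ᵥ x := by
      rw [b.repr_apply_apply, hb _ ⟨1, rfl⟩]
      simp [v, EuclideanSpace.inner_toLp_toLp, dotProduct_comm]
    rw [Fin.sum_univ_two, ← h₁, ← h₂]
    rfl

/-- Slicing by planes parallel to the span of `c₁, c₂`, the part of the ball outside a cylinder
has the volume of a smaller ball. -/
theorem volume_ball_outside_cylinder (m : ℕ) (c₁ c₂ : Fin (2 + m) → ℝ)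
    (hc₁ : ∑ i, (c₁ i) ^ 2 = 1) (hc₂ : ∑ i, (c₂ i) ^ 2 = 1) (hortho : c₁ ⬝ᵥ c₂ = 0)
    {s t : ℝ} (hs : 0 ≤ s) :
    volume {x : Fin (2 + m) → ℝ |
        ∑ i, (x i) ^ 2 ≤ t ∧ s < (c₁ ⬝ᵥ x) ^ 2 + (c₂ ⬝ᵥ x) ^ 2} =
      volume {x : Fin (2 + m) → ℝ | ∑ i, (x i) ^ 2 ≤ t - s} := by
  obtain ⟨T, hT, hsum, hcyl⟩ := exists_measurePreserving_coordinates m c₁ c₂ hc₁ hc₂ hortho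
  let A : Set ((Fin 2 → ℝ) × (Fin m → ℝ)) :=
    {p | ∑ i, (p.1 i) ^ 2 + ∑ i, (p.2 i) ^ 2 ≤ t ∧ s < ∑ i, (p.1 i) ^ 2}
  let B : Set ((Fin 2 → ℝ) × (Fin m → ℝ)) :=
    {p | ∑ i, (p.1 i) ^ 2 + ∑ i, (p.2 i) ^ 2 ≤ t - s}
  have hA : MeasurableSet A := by
    have h₁ : MeasurableSet {p : (Fin 2 → ℝ) × (Fin m → ℝ) |
        ∑ i, (p.1 i) ^ 2 + ∑ i, (p.2 i) ^ 2 ≤ t} :=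
      measurableSet_le (by fun_prop) measurable_const
    have h₂ : MeasurableSet {p : (Fin 2 → ℝ) × (Fin m → ℝ) | s < ∑ i, (p.1 i) ^ 2} :=
      measurableSet_lt measurable_const (by fun_prop)
    convert h₁.inter h₂ using 1
    ext p
    simp [A]
  have hB : MeasurableSet B := measurableSet_le (by fun_prop) measurable_const
  simp only [hsum, hcyl]
  change volume (T ⁻¹' A) = volume (T ⁻¹' B)
  rw [hT.measure_preimage hA.nullMeasurableSet, hT.measure_preimage hB.nullMeasurableSet,
    Measure.volume_eq_prod, Measure.prod_apply_symm hA, Measure.prod_apply_symm hB]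
  refine lintegral_congr fun z ↦ ?_
  have h := volume_annulus (t := t - ∑ i, (z i) ^ 2) hs
  convert h using 2
  · ext y
    simp [A, le_sub_iff_add_le]
  · ext y
    simp only [B, Set.mem_preimage, Set.mem_ofPred_eq]
    constructor <;> intro h <;> linarith

theorem unifBall_outside_cylinder {n : ℕ} (hn : 2 ≤ n) (c₁ c₂ : Fin n → ℝ)
    (hc₁ : ∑ i, (c₁ i) ^ 2 = 1) (hc₂ : ∑ i, (c₂ i) ^ 2 = 1) (hortho : c₁ ⬝ᵥ c₂ = 0)
    {r : ℝ} (hr : 0 ≤ r) (hr' : r ≤ 1) :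
    unifBall n {x | r < √((c₁ ⬝ᵥ x) ^ 2 + (c₂ ⬝ᵥ x) ^ 2)} =
      ENNReal.ofReal ((1 - r ^ 2) ^ ((n : ℝ) / 2)) := by
  obtain ⟨m, rfl⟩ := Nat.exists_eq_add_of_le hn
  have hset : {x | r < √((c₁ ⬝ᵥ x) ^ 2 + (c₂ ⬝ᵥ x) ^ 2)} ∩
      {x : Fin (2 + m) → ℝ | ∑ i, (x i) ^ 2 ≤ 1} =
      {x | ∑ i, (x i) ^ 2 ≤ 1 ∧ r ^ 2 < (c₁ ⬝ᵥ x) ^ 2 + (c₂ ⬝ᵥ x) ^ 2} := by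
    ext x
    simp [Real.lt_sqrt hr, and_comm]
  rw [unifBall, Measure.smul_apply, Measure.restrict_apply' (measurableSet_sum_sq_le _ 1), hset,
    volume_ball_outside_cylinder m c₁ c₂ hc₁ hc₂ hortho (sq_nonneg r),
    volume_sum_sq_le (a := 1 - r ^ 2) _ (by nlinarith), smul_eq_mul, mul_left_comm,
    ENNReal.inv_mul_cancel (volume_sum_sq_le_one_ne_zero _) (volume_sum_sq_le_ne_top _ 1), mul_one]

/-- For orthonormal `c₁, c₂ ∈ ℝⁿ`, `N` i.i.d. samples uniform on the unit Euclidean ball,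
and `κ = maxᵢ ‖(c₁ᵀξ⁽ⁱ⁾, c₂ᵀξ⁽ⁱ⁾)‖₂`, for every `δ ∈ (0,1)`:
`P{κ > 1-δ} = 1 - (1 - (2δ-δ²)^(n/2))^N`. -/
theorem stmt_8 (n N : ℕ) (hn : 2 ≤ n) (hN : 1 ≤ N) (c₁ c₂ : Fin n → ℝ)
    (hc₁ : ∑ i, (c₁ i) ^ 2 = 1) (hc₂ : ∑ i, (c₂ i) ^ 2 = 1)
    (hortho : c₁ ⬝ᵥ c₂ = 0)
    (δ : ℝ) (hδ : δ ∈ Set.Ioo (0 : ℝ) 1) :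
    Measure.pi (fun _ : Fin N => unifBall n)
        {ξ : Fin N → Fin n → ℝ |
          1 - δ < ⨆ i : Fin N, Real.sqrt ((c₁ ⬝ᵥ ξ i) ^ 2 + (c₂ ⬝ᵥ ξ i) ^ 2)} =
      ENNReal.ofReal (1 - (1 - (2 * δ - δ ^ 2) ^ ((n : ℝ) / 2)) ^ N) := by
  obtain ⟨hδ₀, hδ₁⟩ := hδ
  have : Nonempty (Fin N) := ⟨⟨0, hN⟩⟩
  let f : (Fin n → ℝ) → ℝ := fun x ↦ √((c₁ ⬝ᵥ x) ^ 2 + (c₂ ⬝ᵥ x) ^ 2)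
  have hf : Measurable f := by
    simp only [f, dotProduct]
    fun_prop
  have hout : MeasurableSet {x | 1 - δ < f x} := measurableSet_lt measurable_const hf
  have hp : unifBall n {x | 1 - δ < f x} =
      ENNReal.ofReal ((2 * δ - δ ^ 2) ^ ((n : ℝ) / 2)) := by
    rw [unifBall_outside_cylinder hn c₁ c₂ hc₁ hc₂ hortho (by linarith) (by linarith)]
    congr 2
    ring
  have hq₀ : 0 ≤ (2 * δ - δ ^ 2) ^ ((n : ℝ) / 2) := Real.rpow_nonneg (by nlinarith) _
  have hq₁ : (2 * δ - δ ^ 2) ^ ((n : ℝ) / 2) ≤ 1 :=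
    Real.rpow_le_one (by nlinarith) (by nlinarith) (by positivity)
  have hset : {ξ : Fin N → Fin n → ℝ |
      1 - δ < ⨆ i : Fin N, √((c₁ ⬝ᵥ ξ i) ^ 2 + (c₂ ⬝ᵥ ξ i) ^ 2)} =
      (Set.univ.pi fun _ ↦ {x | 1 - δ < f x}ᶜ)ᶜ := by
    ext ξ
    simp [lt_ciSup_iff (Set.finite_range _).bddAbove, f]
  rw [hset, prob_compl_eq_one_sub (MeasurableSet.univ_pi fun _ ↦ hout.compl), Measure.pi_pi,
    Finset.prod_const, Finset.card_univ, Fintype.card_fin, prob_compl_eq_one_sub hout, hp,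
    ← ENNReal.ofReal_one, ← ENNReal.ofReal_sub _ hq₀, ← ENNReal.ofReal_pow (by linarith),
    ← ENNReal.ofReal_sub _ (pow_nonneg (by linarith) N)]
end

section
/- Let n ≥ 1, N ≥ 1, 0 < δ ≤ 1/n, and let ξ^{(1)},…,ξ^{(N)} be i.i.d. random vectors, each uniformly distributed on the cube [−1,1]^n ⊂ ℝ^n. Define η = max_{1≤i≤N} Σ_{j=1}^n ξ_j^{(i)}, the empirical maximum of the linear function g(x) = Σ_{j=1}^n x_j (whose true maximum over the cube equals n). Then P{η > n(1−δ)} = 1 − (1 − n^n δ^n / (2^n n!))^N. -/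
open MeasureTheory

/-- The uniform probability measure on the cube `[-1,1]ⁿ ⊂ ℝⁿ`. -/
noncomputable def unifCube (n : ℕ) : Measure (Fin n → ℝ) :=
  (volume {x : Fin n → ℝ | ∀ i, |x i| ≤ 1})⁻¹ •
    volume.restrict {x : Fin n → ℝ | ∀ i, |x i| ≤ 1}

/-- The corner simplex `{y ≥ 0, ∑ yⱼ < t}` in `ℝⁿ`. -/
def cornerSimplex (n : ℕ) (t : ℝ) : Set (Fin n → ℝ) :=
  {y | (∀ i, 0 ≤ y i) ∧ ∑ i, y i < t}

lemma measurableSet_cornerSimplex (n : ℕ) (t : ℝ) : MeasurableSet (cornerSimplex n t) := by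
  unfold cornerSimplex
  measurability

lemma volume_cornerSimplex (n : ℕ) {t : ℝ} (ht : 0 < t) :
    volume (cornerSimplex n t) = ENNReal.ofReal (t ^ n / n.factorial) := by
  induction n generalizing t with
  | zero =>
    have h : cornerSimplex 0 t = Set.univ := by
      ext y
      simp [cornerSimplex, ht]
    simp [h, volume_pi]
  | succ n ih =>
    have hmp := (volume_preserving_piFinSuccAbove (fun _ : Fin (n + 1) => ℝ) 0).symm
    rw [← hmp.measure_preimage (measurableSet_cornerSimplex _ _).nullMeasurableSet,
      Measure.volume_eq_prod, Measure.prod_apply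
        (hmp.measurable (measurableSet_cornerSimplex _ _))]
    have hslice (x : ℝ) : volume (Prod.mk x ⁻¹'
          ((MeasurableEquiv.piFinSuccAbove (fun _ : Fin (n + 1) => ℝ) 0).symm ⁻¹'
            cornerSimplex (n + 1) t)) =
        (Set.Ico 0 t).indicator
          (fun x => ENNReal.ofReal ((t - x) ^ n / n.factorial)) x := by
      have hmem (y : Fin n → ℝ) : y ∈ Prod.mk x ⁻¹'
          ((MeasurableEquiv.piFinSuccAbove (fun _ : Fin (n + 1) => ℝ) 0).symm ⁻¹'
            cornerSimplex (n + 1) t) ↔ 0 ≤ x ∧ y ∈ cornerSimplex n (t - x) := by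
        simp [cornerSimplex, MeasurableEquiv.piFinSuccAbove, Fin.forall_fin_succ,
          Fin.sum_univ_succ, and_assoc, lt_sub_iff_add_lt']
      by_cases hx : x ∈ Set.Ico 0 t
      · rw [Set.indicator_of_mem hx, ← ih (sub_pos.2 hx.2)]
        congr 1
        ext y
        rw [hmem]
        simp [hx.1]
      · rw [Set.indicator_of_notMem hx, ← measure_empty (μ := (volume : Measure (Fin n → ℝ)))]
        congr 1
        ext y
        rw [hmem]
        simp only [Set.mem_empty_iff_false, iff_false]
        rintro ⟨h0, hy, hs⟩
        exact hx ⟨h0, by linarith [Finset.sum_nonneg fun i (_ : i ∈ Finset.univ) => hy i]⟩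
    simp_rw [hslice]
    rw [lintegral_indicator measurableSet_Ico, restrict_Ico_eq_restrict_Ioc,
      ← ofReal_integral_eq_lintegral_ofReal, ← intervalIntegral.integral_of_le ht.le]
    · congr 1
      rw [intervalIntegral.integral_div,
        intervalIntegral.integral_comp_sub_left (fun x => x ^ n) t, integral_pow,
        Nat.factorial_succ]
      push_cast
      field_simp
      simp
    · exact (Continuous.integrableOn_Icc (by fun_prop)).mono_set Set.Ioc_subset_Icc_self
    · filter_upwards [ae_restrict_mem measurableSet_Ioc] with x hx
      have := sub_nonneg.2 hx.2
      simp only [Pi.zero_apply]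
      positivity

lemma volume_cube (n : ℕ) :
    volume {x : Fin n → ℝ | ∀ i, |x i| ≤ 1} = 2 ^ n := by
  have h : {x : Fin n → ℝ | ∀ i, |x i| ≤ 1} = Set.Icc (fun _ => -1) (fun _ => 1) := by
    ext x
    simp [Pi.le_def, abs_le, forall_and]
  rw [h, Real.volume_Icc_pi]
  norm_num

instance isProbabilityMeasure_unifCube (n : ℕ) : IsProbabilityMeasure (unifCube n) := by
  constructor
  simp [unifCube, volume_cube, ENNReal.inv_mul_cancel]

lemma measurableSet_sum_gt (n : ℕ) (a : ℝ) :
    MeasurableSet {x : Fin n → ℝ | a < ∑ j, x j} :=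
  measurableSet_lt measurable_const (by fun_prop)

/-- A corner cap of the cube of height at most `2` is a simplex. -/
lemma unifCube_sum_gt (n : ℕ) {t : ℝ} (ht : 0 < t) (ht2 : t ≤ 2) :
    unifCube n {x | n - t < ∑ j, x j} =
      ENNReal.ofReal (t ^ n / (2 ^ n * n.factorial)) := by
  have hpre : {x : Fin n → ℝ | n - t < ∑ j, x j} ∩ {x | ∀ i, |x i| ≤ 1} =
      (fun x => 1 - x) ⁻¹' cornerSimplex n t := by
    ext x
    simp only [cornerSimplex, Set.mem_inter_iff, Set.mem_ofPred_eq, Set.mem_preimage,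
      Pi.sub_apply, Pi.one_apply, Finset.sum_sub_distrib, Finset.sum_const,
      Finset.card_univ, Fintype.card_fin, nsmul_eq_mul, mul_one]
    constructor
    · rintro ⟨hs, hx⟩
      exact ⟨fun i => by linarith [(abs_le.1 (hx i)).2], by linarith⟩
    · rintro ⟨hx, hs⟩
      refine ⟨by linarith, fun i => abs_le.2 ⟨?_, by linarith [hx i]⟩⟩
      have h := Finset.single_le_sum (f := fun i => 1 - x i) (fun i _ => hx i)
        (Finset.mem_univ i)
      simp only [Finset.sum_sub_distrib, Finset.sum_const,
        Finset.card_univ, Fintype.card_fin, nsmul_eq_mul, mul_one] at h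
      linarith
  rw [unifCube, Measure.smul_apply, Measure.restrict_apply (measurableSet_sum_gt n _), hpre,
    (Measure.measurePreserving_sub_left volume (1 : Fin n → ℝ)).measure_preimage
      (measurableSet_cornerSimplex n t).nullMeasurableSet,
    volume_cornerSimplex n ht, volume_cube, smul_eq_mul]
  have h2 : ((2 : ENNReal) ^ n)⁻¹ = ENNReal.ofReal ((2 ^ n)⁻¹) := by
    rw [ENNReal.ofReal_inv_of_pos (by positivity), ENNReal.ofReal_pow (by norm_num)]
    norm_num
  rw [h2, ← ENNReal.ofReal_mul (by positivity)]
  congr 1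
  field_simp

/-- Theorem 5 (cube, diagonal direction): for `N` i.i.d. samples uniform on `[-1,1]ⁿ`
and the empirical maximum `η = maxᵢ Σⱼ ξⱼ⁽ⁱ⁾` of `g(x) = Σⱼ xⱼ`, for `0 < δ ≤ 1/n`:
`P{η > n(1-δ)} = 1 - (1 - nⁿδⁿ/(2ⁿ n!))^N`. -/
theorem stmt_13 (n N : ℕ) (hn : 1 ≤ n) (hN : 1 ≤ N)
    (δ : ℝ) (hδ0 : 0 < δ) (hδ : δ ≤ 1 / n) :
    Measure.pi (fun _ : Fin N => unifCube n)
        {ξ : Fin N → Fin n → ℝ | (n : ℝ) * (1 - δ) < ⨆ i : Fin N, ∑ j, ξ i j} =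
      ENNReal.ofReal
        (1 - (1 - (n : ℝ) ^ n * δ ^ n / (2 ^ n * n.factorial)) ^ N) := by
  have : Nonempty (Fin N) := ⟨⟨0, hN⟩⟩
  have hn0 : (0 : ℝ) < n := by exact_mod_cast hn
  have ht : (n : ℝ) * δ ≤ 1 := by
    rwa [le_div_iff₀ hn0, mul_comm] at hδ
  have hcap := unifCube_sum_gt n (mul_pos hn0 hδ0) (ht.trans one_le_two)
  set A : Set (Fin n → ℝ) := {x | n - n * δ < ∑ j, x j} with hA
  have hAm : MeasurableSet A := measurableSet_sum_gt n _
  have hset : {ξ : Fin N → Fin n → ℝ | (n : ℝ) * (1 - δ) < ⨆ i : Fin N, ∑ j, ξ i j} =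
      (Set.univ.pi fun _ => Aᶜ)ᶜ := by
    ext ξ
    simp [lt_ciSup_iff (Set.finite_range _).bddAbove, hA, mul_sub]
  have hle : ((n : ℝ) * δ) ^ n / (2 ^ n * n.factorial) ≤ 1 := by
    rw [← ENNReal.ofReal_le_one, ← hcap]
    exact prob_le_one
  have hnonneg : 0 ≤ ((n : ℝ) * δ) ^ n / (2 ^ n * n.factorial) := by positivity
  rw [hset, prob_compl_eq_one_sub (MeasurableSet.univ_pi fun _ => hAm.compl), Measure.pi_pi,
    prob_compl_eq_one_sub hAm, hcap, Finset.prod_const, Finset.card_univ, Fintype.card_fin,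
    ← mul_pow, ENNReal.ofReal_sub _ (pow_nonneg (by linarith) _),
    ENNReal.ofReal_pow (by linarith), ENNReal.ofReal_sub _ hnonneg, ENNReal.ofReal_one]
end

section
/- Let n ≥ 1, p ∈ (0,1), δ ∈ (0,1), and let ξ^{(1)},…,ξ^{(N)} be i.i.d. random vectors, each uniformly distributed on the unit l₁-ball Q = {x ∈ ℝ^n : Σ_{i=1}^n |x_i| ≤ 1}, with empirical maximum η = max_{1≤i≤N} ξ₁^{(i)} of the function g(x) = x₁ (whose true maximum over Q equals 1). Then P{η > 1−δ} = 1 − (1 − δ^n/2)^N, and P{η > 1−δ} ≥ p if and only if N ≥ ln(1−p) / ln(1 − δ^n/2); i.e., the minimal sample size guaranteeing a δ-accurate estimate with probability at least p is N_min = ⌈ln(1−p) / ln(1 − δ^n/2)⌉. -/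
open MeasureTheory

/-- The uniform probability measure on the unit `l₁`-ball in `ℝⁿ`. -/
noncomputable def unifL1Ball (n : ℕ) : Measure (Fin n → ℝ) :=
  (volume {x : Fin n → ℝ | ∑ i, |x i| ≤ 1})⁻¹ •
    volume.restrict {x : Fin n → ℝ | ∑ i, |x i| ≤ 1}

section L1Ball

variable {n : ℕ}

lemma measurableSet_l1Ball (r : ℝ) : MeasurableSet {x : Fin n → ℝ | ∑ i, |x i| ≤ r} :=
  measurableSet_le (by fun_prop) (by fun_prop)

lemma volume_l1Ball_ne_zero : volume {x : Fin n → ℝ | ∑ i, |x i| ≤ 1} ≠ 0 := by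
  have h : {x : Fin n → ℝ | ∑ i, |x i| < 1} ⊆ {x | ∑ i, |x i| ≤ 1} := by
    intro x hx
    exact le_of_lt (show ∑ i, |x i| < 1 from hx)
  have hopen : IsOpen {x : Fin n → ℝ | ∑ i, |x i| < 1} :=
    isOpen_lt (by fun_prop) continuous_const
  exact (measure_pos_of_superset h (hopen.measure_pos volume ⟨0, by simp⟩).ne').ne'

lemma volume_l1Ball_ne_top : volume {x : Fin n → ℝ | ∑ i, |x i| ≤ 1} ≠ ⊤ := by
  refine ((measure_mono fun x hx => ?_).trans_lt
    (measure_closedBall_lt_top (x := (0 : Fin n → ℝ)) (r := 1))).ne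
  rw [mem_closedBall_zero_iff, pi_norm_le_iff_of_nonneg zero_le_one]
  exact fun i => (Finset.single_le_sum (f := fun i => |x i|)
    (fun i _ => abs_nonneg _) (Finset.mem_univ i)).trans hx

lemma volume_l1Ball_eq_pow_mul {r : ℝ} (hr : 0 < r) :
    volume {x : Fin n → ℝ | ∑ i, |x i| ≤ r} =
      ENNReal.ofReal (r ^ n) * volume {x : Fin n → ℝ | ∑ i, |x i| ≤ 1} := by
  have h := Measure.addHaar_preimage_smul (volume : Measure (Fin n → ℝ)) (inv_ne_zero hr.ne')
    {x : Fin n → ℝ | ∑ i, |x i| ≤ 1}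
  have h' : (fun x : Fin n → ℝ => r⁻¹ • x) ⁻¹' {x | ∑ i, |x i| ≤ 1} =
      {x | ∑ i, |x i| ≤ r} := by
    ext x
    simp only [Set.mem_preimage, Set.mem_ofPred_eq, Pi.smul_apply, smul_eq_mul, abs_mul,
      abs_inv, abs_of_pos hr, ← Finset.mul_sum]
    rw [inv_mul_le_iff₀ hr, mul_one]
  rw [h', Module.finrank_fin_fun, inv_pow, inv_inv, abs_of_pos (pow_pos hr n)] at h
  exact h

lemma two_mul_volume_half_l1Ball (k : Fin n) (r : ℝ) :
    2 * volume ({x : Fin n → ℝ | ∑ i, |x i| ≤ r} ∩ {x | 0 < x k}) =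
      volume {x : Fin n → ℝ | ∑ i, |x i| ≤ r} := by
  set Q := {x : Fin n → ℝ | ∑ i, |x i| ≤ r} with hQ
  have hP : MeasurableSet {x : Fin n → ℝ | 0 < x k} :=
    measurableSet_lt (by fun_prop) (by fun_prop)
  have hneg : volume (Q ∩ {x | x k < 0}) = volume (Q ∩ {x | 0 < x k}) := by
    rw [← Measure.measure_preimage_neg]
    congr 1
    ext x
    simp [hQ]
  have hae : (Q \ {x | 0 < x k} : Set (Fin n → ℝ)) =ᵐ[volume] (Q ∩ {x | x k < 0} : Set _) := by
    have h0 : ∀ᵐ x : Fin n → ℝ, x k ≠ 0 := by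
      rw [ae_iff]
      simpa [volume_pi] using Measure.pi_hyperplane (fun _ : Fin n => (volume : Measure ℝ)) k 0
    filter_upwards [h0] with x hx
    refine propext (and_congr_right fun _ => ?_)
    exact not_lt.trans ⟨fun h => lt_of_le_of_ne h hx, le_of_lt⟩
  rw [← measure_inter_add_sdiff Q hP, measure_congr hae, hneg, two_mul]

lemma volume_l1Ball_cap (k : Fin n) {δ : ℝ} (hδ : 0 < δ) (hδ1 : δ ≤ 1) :
    volume ({x : Fin n → ℝ | ∑ i, |x i| ≤ 1} ∩ {x | 1 - δ < x k}) =
      ENNReal.ofReal (δ ^ n / 2) * volume {x : Fin n → ℝ | ∑ i, |x i| ≤ 1} := by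
  have htrans : volume ({x : Fin n → ℝ | ∑ i, |x i| ≤ 1} ∩ {x | 1 - δ < x k}) =
      volume ({x : Fin n → ℝ | ∑ i, |x i| ≤ δ} ∩ {x | 0 < x k}) := by
    rw [← measure_preimage_add_right volume (Pi.single k (1 - δ))]
    congr 1
    ext x
    simp only [Set.mem_preimage, Set.mem_inter_iff, Set.mem_ofPred_eq, Pi.add_apply,
      Pi.single_eq_same, lt_add_iff_pos_left]
    refine and_congr_left fun hx => ?_
    have h : ∑ i, |x i + Pi.single (M := fun _ => ℝ) k (1 - δ) i| = ∑ i, |x i| + (1 - δ) := by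
      rw [← Finset.add_sum_erase _ _ (Finset.mem_univ k),
        ← Finset.add_sum_erase _ (fun i => |x i|) (Finset.mem_univ k), Pi.single_eq_same,
        abs_of_pos hx, abs_of_nonneg (by linarith : 0 ≤ x k + (1 - δ)),
        Finset.sum_congr rfl fun i hi => by
          rw [Pi.single_eq_of_ne (Finset.ne_of_mem_erase hi), add_zero]]
      ring
    rw [h]
    constructor <;> intro h <;> linarith
  have h2 := two_mul_volume_half_l1Ball k δ
  rw [volume_l1Ball_eq_pow_mul hδ] at h2
  rw [htrans, ENNReal.ofReal_div_of_pos two_pos, ENNReal.ofReal_ofNat, div_eq_mul_inv,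
    mul_right_comm, ← h2, mul_comm, ← mul_assoc,
    ENNReal.inv_mul_cancel two_ne_zero ENNReal.ofNat_ne_top, one_mul]

instance isProbabilityMeasure_unifL1Ball : IsProbabilityMeasure (unifL1Ball n) := by
  constructor
  rw [unifL1Ball, Measure.smul_apply, Measure.restrict_apply_univ, smul_eq_mul,
    ENNReal.inv_mul_cancel volume_l1Ball_ne_zero volume_l1Ball_ne_top]

lemma unifL1Ball_cap (k : Fin n) {δ : ℝ} (hδ : 0 < δ) (hδ1 : δ ≤ 1) :
    unifL1Ball n {x | 1 - δ < x k} = ENNReal.ofReal (δ ^ n / 2) := by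
  rw [unifL1Ball, Measure.smul_apply, Measure.restrict_apply' (measurableSet_l1Ball 1),
    Set.inter_comm, volume_l1Ball_cap k hδ hδ1, smul_eq_mul, mul_left_comm,
    ENNReal.inv_mul_cancel volume_l1Ball_ne_zero volume_l1Ball_ne_top, mul_one]

lemma pi_unifL1Ball_lt_iSup (k : Fin n) {δ : ℝ} (hδ : 0 < δ) (hδ1 : δ ≤ 1) (N : ℕ) :
    Measure.pi (fun _ : Fin N => unifL1Ball n)
        {ξ : Fin N → Fin n → ℝ | 1 - δ < ⨆ i : Fin N, ξ i k} =
      ENNReal.ofReal (1 - (1 - δ ^ n / 2) ^ N) := by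
  have hq : 0 ≤ 1 - δ ^ n / 2 := by
    linarith [pow_le_one₀ (n := n) hδ.le hδ1]
  have hmeas : MeasurableSet {x : Fin n → ℝ | 1 - δ < x k} :=
    measurableSet_lt (by fun_prop) (by fun_prop)
  have hset : {ξ : Fin N → Fin n → ℝ | 1 - δ < ⨆ i : Fin N, ξ i k} =
      (Set.univ.pi fun _ => {x : Fin n → ℝ | 1 - δ < x k}ᶜ)ᶜ := by
    ext ξ
    simp only [Set.mem_ofPred_eq, Set.mem_compl_iff, Set.mem_pi, Set.mem_univ, true_imp_iff,
      ← not_le (b := 1 - δ), not_not]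
    exact not_congr ⟨fun h i => (le_ciSup (Set.finite_range fun i => ξ i k).bddAbove i).trans h,
      fun h => Real.iSup_le h (by linarith)⟩
  rw [hset, prob_compl_eq_one_sub (MeasurableSet.univ_pi fun _ => hmeas.compl), Measure.pi_pi,
    Finset.prod_const, Finset.card_univ, Fintype.card_fin, prob_compl_eq_one_sub hmeas,
    unifL1Ball_cap k hδ hδ1, ← ENNReal.ofReal_one, ← ENNReal.ofReal_sub _ (by positivity),
    ← ENNReal.ofReal_pow hq, ← ENNReal.ofReal_sub _ (by positivity)]

end L1Ball

lemma le_one_sub_pow_iff_log_div_log_le {p q : ℝ} (hp : p < 1) (hq0 : 0 < q) (hq1 : q < 1)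
    (N : ℕ) : p ≤ 1 - q ^ N ↔ Real.log (1 - p) / Real.log q ≤ N := by
  rw [div_le_iff_of_neg (Real.log_neg hq0 hq1), ← Real.log_pow,
    Real.log_le_log_iff (by positivity) (by linarith), le_sub_comm]

/-- Theorem 6 (`l₁`-ball): for `N` i.i.d. samples uniform on the unit `l₁`-ball in `ℝⁿ`
with empirical maximum `η = maxᵢ ξ₁⁽ⁱ⁾` of `g(x) = x₁`,
`P{η > 1-δ} = 1 - (1-δⁿ/2)^N`; moreover `P{η > 1-δ} ≥ p` iff
`N ≥ ln(1-p)/ln(1-δⁿ/2)`, so the minimal such sample size is the ceiling of that ratio. -/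
theorem stmt_16 (n : ℕ) (hn : 1 ≤ n) (p δ : ℝ)
    (hp : p ∈ Set.Ioo (0 : ℝ) 1) (hδ : δ ∈ Set.Ioo (0 : ℝ) 1) :
    (∀ N : ℕ, 1 ≤ N →
      Measure.pi (fun _ : Fin N => unifL1Ball n)
          {ξ : Fin N → Fin n → ℝ | 1 - δ < ⨆ i : Fin N, ξ i ⟨0, hn⟩} =
        ENNReal.ofReal (1 - (1 - δ ^ n / 2) ^ N)) ∧
    (∀ N : ℕ,
      ENNReal.ofReal p ≤
          Measure.pi (fun _ : Fin N => unifL1Ball n)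
            {ξ : Fin N → Fin n → ℝ | 1 - δ < ⨆ i : Fin N, ξ i ⟨0, hn⟩} ↔
        Real.log (1 - p) / Real.log (1 - δ ^ n / 2) ≤ (N : ℝ)) ∧
    IsLeast
      {N : ℕ |
        ENNReal.ofReal p ≤
          Measure.pi (fun _ : Fin N => unifL1Ball n)
            {ξ : Fin N → Fin n → ℝ | 1 - δ < ⨆ i : Fin N, ξ i ⟨0, hn⟩}}
      ⌈Real.log (1 - p) / Real.log (1 - δ ^ n / 2)⌉₊ := by
  have hpow : 0 < δ ^ n := pow_pos hδ.1 n
  have hpow1 : δ ^ n ≤ 1 := pow_le_one₀ hδ.1.le hδ.2.le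
  have hprob := pi_unifL1Ball_lt_iSup (⟨0, hn⟩ : Fin n) hδ.1 hδ.2.le
  have hiff : ∀ N : ℕ,
      ENNReal.ofReal p ≤
          Measure.pi (fun _ : Fin N => unifL1Ball n)
            {ξ : Fin N → Fin n → ℝ | 1 - δ < ⨆ i : Fin N, ξ i ⟨0, hn⟩} ↔
        Real.log (1 - p) / Real.log (1 - δ ^ n / 2) ≤ (N : ℝ) := fun N => by
    rw [hprob, ← le_one_sub_pow_iff_log_div_log_le hp.2 (by linarith) (by linarith),
      ENNReal.ofReal_le_ofReal_iff
        (sub_nonneg.2 (pow_le_one₀ (by linarith) (by linarith)))]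
  exact ⟨fun N _ => hprob N, hiff, (hiff _).2 (Nat.le_ceil _),
    fun N hN => Nat.ceil_le.2 ((hiff N).1 hN)⟩
end
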